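/- Let U ⊆ ℝ⁵ be open with coordinates (x,y,z,t,u) and let φ₁, …, φ₆ : U → ℂ be twice continuously differentiable. Define the complex 1-form ω = h_x dx + h_y dy + h_z dz + h_t dt + h_u du, where h_x = i(φ₁φ₂ + φ₃φ₄)φ₅ − ½(φ₁² + φ₂² − φ₃² − φ₄²)φ₆, h_y = i(−φ₁φ₃ + φ₂φ₄)φ₅ + (φ₂φ₃ − φ₁φ₄)φ₆, h_z = (−φ₁φ₂ + φ₃φ₄)φ₅ − (i/2)(φ₁² + φ₂² + φ₃² + φ₄²)φ₆, h_t = (φ₁φ₃ + φ₂φ₄)φ₅, h_u = (φ₁φ₃ + φ₂φ₄)φ₆. Define the complex 1-form η = X dφ₁ + Y dφ₂ + Z dφ₃ + T dφ₄ + U' dφ₅ + W dφ₆, where X = φ₃φ₅(t − iy) − (φ₁φ₆ − iφ₂φ₅)(x + iz) − φ₄φ₆ y + φ₃φ₆ u, Y = φ₄φ₅(t + iy) − (φ₂φ₆ − iφ₁φ₅)(x + iz) + φ₃φ₆ y + φ₄φ₆ u, Z = φ₁φ₅(t − iy) + (φ₃φ₆ + iφ₄φ₅)(x − iz) + φ₂φ₆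 y + φ₁φ₆ u, T = φ₂φ₅(t + iy) + (φ₄φ₆ + iφ₃φ₅)(x − iz) − φ₁φ₆ y + φ₂φ₆ u, U' = φ₁φ₃(t − iy) + φ₂φ₄(t + iy) + iφ₁φ₂(x + iz) + iφ₃φ₄(x − iz), W = −½(φ₁² + φ₂²)(x + iz) + ½(φ₃² + φ₄²)(x − iz) + (φ₂φ₃ − φ₁φ₄) y + (φ₁φ₃ + φ₂φ₄) u. Then ω is closed on U if and only if η is closed on U. -/

import Mathlib

open Complex Finset

/-- Partial derivative of a complex-valued function on `ℝⁿ` in the `k`-th coordinate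
direction. -/
noncomputable def pdC {n : ℕ} (f : (Fin n → ℝ) → ℂ) (k : Fin n) (x : Fin n → ℝ) : ℂ :=
  fderiv ℝ f x (Pi.single k 1)

section PartialDerivatives

variable {n : ℕ} {f g : (Fin n → ℝ) → ℂ} {x : Fin n → ℝ} {k : Fin n}

theorem pdC_add (hf : DifferentiableAt ℝ f x) (hg : DifferentiableAt ℝ g x) :
    pdC (fun p => f p + g p) k x = pdC f k x + pdC g k x := by
  simp [pdC, fderiv_fun_add hf hg]

theorem pdC_sub (hf : DifferentiableAt ℝ f x) (hg : DifferentiableAt ℝ g x) :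
    pdC (fun p => f p - g p) k x = pdC f k x - pdC g k x := by
  simp [pdC, fderiv_fun_sub hf hg]

theorem pdC_neg : pdC (fun p => -f p) k x = -pdC f k x := by
  simp [pdC, fderiv_fun_neg]

theorem pdC_mul (hf : DifferentiableAt ℝ f x) (hg : DifferentiableAt ℝ g x) :
    pdC (fun p => f p * g p) k x = f x * pdC g k x + g x * pdC f k x := by
  simp [pdC, fderiv_fun_mul hf hg]

theorem pdC_const (c : ℂ) : pdC (fun _ => c) k x = 0 := by
  simp [pdC]

theorem hasFDerivAt_ofReal_apply (i : Fin n) (x : Fin n → ℝ) :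
    HasFDerivAt (fun p : Fin n → ℝ => (p i : ℂ))
      (Complex.ofRealCLM.comp (ContinuousLinearMap.proj i)) x :=
  (Complex.ofRealCLM.comp
    (ContinuousLinearMap.proj (R := ℝ) (φ := fun _ : Fin n => ℝ) i)).hasFDerivAt

theorem pdC_ofReal_apply (i : Fin n) :
    pdC (fun p => (p i : ℂ)) k x = if i = k then 1 else 0 := by
  simp [pdC, (hasFDerivAt_ofReal_apply i x).fderiv, Pi.single_apply, apply_ite]

@[fun_prop]
theorem contDiff_ofReal_apply (i : Fin n) {m : WithTop ℕ∞} :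
    ContDiff ℝ m (fun p : Fin n → ℝ => (p i : ℂ)) :=
  Complex.ofRealCLM.contDiff.comp (contDiff_apply ℝ ℝ i)

@[fun_prop]
theorem differentiableAt_ofReal_apply (i : Fin n) (x : Fin n → ℝ) :
    DifferentiableAt ℝ (fun p : Fin n → ℝ => (p i : ℂ)) x :=
  (hasFDerivAt_ofReal_apply i x).differentiableAt

theorem pdC_congr_of_eqOn {U : Set (Fin n → ℝ)} (hU : IsOpen U) (hx : x ∈ U)
    (h : Set.EqOn f g U) : pdC f k x = pdC g k x := by
  rw [pdC, pdC, (h.eventuallyEq_of_mem (hU.mem_nhds hx)).fderiv_eq]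

theorem differentiableAt_pdC (hf : ContDiffAt ℝ 2 f x) (k : Fin n) :
    DifferentiableAt ℝ (pdC f k) x :=
  ((hf.fderiv_right (m := 1) (by norm_num)).differentiableAt (by norm_num)).clm_apply
    (differentiableAt_const _)

/-- Partial derivatives of a `C²` function commute. -/
theorem pdC_pdC_comm (hf : ContDiffAt ℝ 2 f x) (j k : Fin n) :
    pdC (pdC f k) j x = pdC (pdC f j) k x := by
  have hd : DifferentiableAt ℝ (fderiv ℝ f) x :=
    (hf.fderiv_right (m := 1) (by norm_num)).differentiableAt (by norm_num)
  have key : ∀ a b : Fin n,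
      pdC (pdC f a) b x = fderiv ℝ (fderiv ℝ f) x (Pi.single b 1) (Pi.single a 1) := by
    intro a b
    change fderiv ℝ (fun y => fderiv ℝ f y (Pi.single a 1)) x (Pi.single b 1) = _
    rw [fderiv_clm_apply hd (differentiableAt_const _)]
    simp
  rw [key, key]
  exact (hf.isSymmSndFDerivAt (by simp)).eq _ _

/-- If `ω + η` is the differential of a `C²` function, then `ω` and `η` are closed together. -/
theorem closed_iff_closed_of_add_eq_pdC {U : Set (Fin n → ℝ)} (hU : IsOpen U)
    {F : (Fin n → ℝ) → ℂ} (hF : ContDiffOn ℝ 2 F U) {ω η : Fin n → (Fin n → ℝ) → ℂ}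
    (hω : ∀ k, ∀ x ∈ U, DifferentiableAt ℝ (ω k) x)
    (h : ∀ k, ∀ x ∈ U, η k x = pdC F k x - ω k x) :
    (∀ x ∈ U, ∀ j k, pdC (ω k) j x - pdC (ω j) k x = 0) ↔
      (∀ x ∈ U, ∀ j k, pdC (η k) j x - pdC (η j) k x = 0) := by
  refine forall₂_congr fun x hx => forall₂_congr fun j k => ?_
  have hFx := hF.contDiffAt (hU.mem_nhds hx)
  have hη : ∀ a b, pdC (η a) b x = pdC (pdC F a) b x - pdC (ω a) b x := fun a b => by
    rw [pdC_congr_of_eqOn hU hx (h a), pdC_sub (differentiableAt_pdC hFx a) (hω a x hx)]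
  rw [hη, hη, pdC_pdC_comm hFx j k, sub_sub_sub_cancel_left, ← neg_sub, neg_eq_zero]

end PartialDerivatives

/-- on an open `U ⊆ ℝ⁵` with coordinates
`(x, y, z, t, u) = (p 0, p 1, p 2, p 3, p 4)` and `C²` functions `φ₁, …, φ₆ : U → ℂ`, the
1-form `ω = h_x dx + h_y dy + h_z dz + h_t dt + h_u du` of the trilinear parametrization is
closed iff the 1-form `η = X dφ₁ + Y dφ₂ + Z dφ₃ + T dφ₄ + U' dφ₅ + W dφ₆` is closed. -/
theorem omega_closed_iff_eta_closed_dim5 (U : Set (Fin 5 → ℝ)) (hU : IsOpen U)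
    (φ₁ φ₂ φ₃ φ₄ φ₅ φ₆ : (Fin 5 → ℝ) → ℂ)
    (hφ₁ : ContDiffOn ℝ 2 φ₁ U) (hφ₂ : ContDiffOn ℝ 2 φ₂ U)
    (hφ₃ : ContDiffOn ℝ 2 φ₃ U) (hφ₄ : ContDiffOn ℝ 2 φ₄ U)
    (hφ₅ : ContDiffOn ℝ 2 φ₅ U) (hφ₆ : ContDiffOn ℝ 2 φ₆ U)
    (ω : Fin 5 → (Fin 5 → ℝ) → ℂ)
    (hω : ω = ![
      fun p => Complex.I * (φ₁ p * φ₂ p + φ₃ p * φ₄ p) * φ₅ p -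
        (1 / 2 : ℂ) * (φ₁ p ^ 2 + φ₂ p ^ 2 - φ₃ p ^ 2 - φ₄ p ^ 2) * φ₆ p,
      fun p => Complex.I * (-φ₁ p * φ₃ p + φ₂ p * φ₄ p) * φ₅ p +
        (φ₂ p * φ₃ p - φ₁ p * φ₄ p) * φ₆ p,
      fun p => (-φ₁ p * φ₂ p + φ₃ p * φ₄ p) * φ₅ p -
        (Complex.I / 2) * (φ₁ p ^ 2 + φ₂ p ^ 2 + φ₃ p ^ 2 + φ₄ p ^ 2) * φ₆ p,
      fun p => (φ₁ p * φ₃ p + φ₂ p * φ₄ p) * φ₅ p,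
      fun p => (φ₁ p * φ₃ p + φ₂ p * φ₄ p) * φ₆ p])
    (X Y Z T U' W : (Fin 5 → ℝ) → ℂ)
    (hX : X = fun p => φ₃ p * φ₅ p * ((p 3 : ℂ) - Complex.I * (p 1 : ℂ)) -
      (φ₁ p * φ₆ p - Complex.I * φ₂ p * φ₅ p) * ((p 0 : ℂ) + Complex.I * (p 2 : ℂ)) -
      φ₄ p * φ₆ p * (p 1 : ℂ) + φ₃ p * φ₆ p * (p 4 : ℂ))
    (hY : Y = fun p => φ₄ p * φ₅ p * ((p 3 : ℂ) + Complex.I * (p 1 : ℂ)) -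
      (φ₂ p * φ₆ p - Complex.I * φ₁ p * φ₅ p) * ((p 0 : ℂ) + Complex.I * (p 2 : ℂ)) +
      φ₃ p * φ₆ p * (p 1 : ℂ) + φ₄ p * φ₆ p * (p 4 : ℂ))
    (hZ : Z = fun p => φ₁ p * φ₅ p * ((p 3 : ℂ) - Complex.I * (p 1 : ℂ)) +
      (φ₃ p * φ₆ p + Complex.I * φ₄ p * φ₅ p) * ((p 0 : ℂ) - Complex.I * (p 2 : ℂ)) +
      φ₂ p * φ₆ p * (p 1 : ℂ) + φ₁ p * φ₆ p * (p 4 : ℂ))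
    (hT : T = fun p => φ₂ p * φ₅ p * ((p 3 : ℂ) + Complex.I * (p 1 : ℂ)) +
      (φ₄ p * φ₆ p + Complex.I * φ₃ p * φ₅ p) * ((p 0 : ℂ) - Complex.I * (p 2 : ℂ)) -
      φ₁ p * φ₆ p * (p 1 : ℂ) + φ₂ p * φ₆ p * (p 4 : ℂ))
    (hU' : U' = fun p => φ₁ p * φ₃ p * ((p 3 : ℂ) - Complex.I * (p 1 : ℂ)) +
      φ₂ p * φ₄ p * ((p 3 : ℂ) + Complex.I * (p 1 : ℂ)) +
      Complex.I * φ₁ p * φ₂ p * ((p 0 : ℂ) + Complex.I * (p 2 : ℂ)) +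
      Complex.I * φ₃ p * φ₄ p * ((p 0 : ℂ) - Complex.I * (p 2 : ℂ)))
    (hW : W = fun p => -(1 / 2 : ℂ) * (φ₁ p ^ 2 + φ₂ p ^ 2) * ((p 0 : ℂ) + Complex.I * (p 2 : ℂ)) +
      (1 / 2 : ℂ) * (φ₃ p ^ 2 + φ₄ p ^ 2) * ((p 0 : ℂ) - Complex.I * (p 2 : ℂ)) +
      (φ₂ p * φ₃ p - φ₁ p * φ₄ p) * (p 1 : ℂ) +
      (φ₁ p * φ₃ p + φ₂ p * φ₄ p) * (p 4 : ℂ))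
    (η : Fin 5 → (Fin 5 → ℝ) → ℂ)
    (hη : ∀ k p, η k p = X p * pdC φ₁ k p + Y p * pdC φ₂ k p + Z p * pdC φ₃ k p +
      T p * pdC φ₄ k p + U' p * pdC φ₅ k p + W p * pdC φ₆ k p) :
    (∀ x ∈ U, ∀ j k : Fin 5, pdC (ω k) j x - pdC (ω j) k x = 0) ↔
      (∀ x ∈ U, ∀ j k : Fin 5, pdC (η k) j x - pdC (η j) k x = 0) := by
  have hωC : ∀ k, ContDiffOn ℝ 2 (ω k) U := by
    intro k
    subst hω
    fin_cases k <;> simp <;> fun_prop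
  have hF : ContDiffOn ℝ 2 (fun p => ∑ i, (p i : ℂ) * ω i p) U :=
    ContDiffOn.sum fun i _ => (contDiff_ofReal_apply i).contDiffOn.mul (hωC i)
  have diff : ∀ {f : (Fin 5 → ℝ) → ℂ}, ContDiffOn ℝ 2 f U → ∀ x ∈ U, DifferentiableAt ℝ f x :=
    fun hf x hx => (hf.contDiffAt (hU.mem_nhds hx)).differentiableAt (by norm_num)
  refine closed_iff_closed_of_add_eq_pdC hU hF (fun k => diff (hωC k)) fun k x hx => ?_
  have d₁ := diff hφ₁ x hx
  have d₂ := diff hφ₂ x hx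
  have d₃ := diff hφ₃ x hx
  have d₄ := diff hφ₄ x hx
  have d₅ := diff hφ₅ x hx
  have d₆ := diff hφ₆ x hx
  subst hω hX hY hZ hT hU' hW
  rw [hη]
  simp only [Fin.sum_univ_five, Matrix.cons_val, pow_two]
  simp (disch := fun_prop) only [pdC_add, pdC_sub, pdC_neg, pdC_mul, pdC_const, pdC_ofReal_apply]
  fin_cases k <;> simp <;> ring_nf <;> simp only [Complex.I_sq] <;> ring
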